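/- For every fixed η ∈ (0,1), lim_{p→1⁻} ∑_{i=1}^∞ (p^{i−1} − p^i) / ((i+1)p^i − i p^{i+1} + 1/η − 1) = ∫_0^1 1/(y(1 − ln y) + 1/η − 1) dy. -/

import Mathlib

open Filter Topology Set

lemma monotoneOn_mul_one_sub_log :
    MonotoneOn (fun y : ℝ => y * (1 - Real.log y)) (Icc 0 1) := by
  intro a ha b hb hab
  rcases ha.1.eq_or_lt with rfl | ha0
  · have := Real.log_nonpos hb.1 hb.2
    have : 0 ≤ b * (1 - Real.log b) := mul_nonneg hb.1 (by linarith)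
    simpa using this
  · have hb0 : 0 < b := ha0.trans_le hab
    have hlog := Real.log_le_sub_one_of_pos (div_pos hb0 ha0)
    rw [Real.log_div hb0.ne' ha0.ne'] at hlog
    have h1 := mul_le_mul_of_nonneg_left hlog ha0.le
    have h2 : a * (b / a - 1) = b - a := by field_simp
    have h3 := mul_nonneg (sub_nonneg.2 hab) (neg_nonneg.2 (Real.log_nonpos hb.1 hb.2))
    dsimp only
    nlinarith

lemma mul_one_sub_log_nonneg {y : ℝ} (hy : y ∈ Icc (0 : ℝ) 1) : 0 ≤ y * (1 - Real.log y) :=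
  mul_nonneg hy.1 (by linarith [Real.log_nonpos hy.1 hy.2])

section GeometricPartition

variable {g : ℝ → ℝ} {p : ℝ}

lemma AntitoneOn.intervalIntegrable_of_Icc_zero_one (hg : AntitoneOn g (Icc 0 1)) {a b : ℝ}
    (ha : a ∈ Icc (0 : ℝ) 1) (hb : b ∈ Icc (0 : ℝ) 1) :
    IntervalIntegrable g MeasureTheory.volume a b :=
  (hg.mono ((convex_Icc (0 : ℝ) 1).ordConnected.uIcc_subset ha hb)).intervalIntegrable

lemma pow_mem_Icc_zero_one (hp : p ∈ Ioo (0 : ℝ) 1) (n : ℕ) : p ^ n ∈ Icc (0 : ℝ) 1 :=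
  ⟨pow_nonneg hp.1.le n, pow_le_one₀ hp.1.le hp.2.le⟩

lemma sum_integral_geometric (hg : AntitoneOn g (Icc 0 1)) (hp : p ∈ Ioo (0 : ℝ) 1) (N : ℕ) :
    ∑ i ∈ Finset.range N, ∫ y in p ^ (i + 1)..p ^ i, g y = ∫ y in p ^ N..1, g y := by
  have h := intervalIntegral.sum_integral_adjacent_intervals (f := g) (a := fun i => p ^ i)
    (n := N) (μ := MeasureTheory.volume) fun k _ => hg.intervalIntegrable_of_Icc_zero_one
      (pow_mem_Icc_zero_one hp k) (pow_mem_Icc_zero_one hp (k + 1))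
  rw [pow_zero] at h
  rw [intervalIntegral.integral_symm, ← h, ← Finset.sum_neg_distrib]
  exact Finset.sum_congr rfl fun i _ => intervalIntegral.integral_symm _ _

lemma AntitoneOn.integral_le_sub_mul (hg : AntitoneOn g (Icc 0 1)) {a b : ℝ}
    (ha : 0 ≤ a) (hab : a ≤ b) (hb : b ≤ 1) : ∫ y in a..b, g y ≤ (b - a) * g a := by
  have hi := hg.intervalIntegrable_of_Icc_zero_one ⟨ha, hab.trans hb⟩ ⟨ha.trans hab, hb⟩
  have h := intervalIntegral.integral_mono_on hab hi intervalIntegrable_const fun y hy =>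
    hg ⟨ha, hab.trans hb⟩ ⟨ha.trans hy.1, hy.2.trans hb⟩ hy.1
  simpa using h

lemma AntitoneOn.sub_mul_le_integral (hg : AntitoneOn g (Icc 0 1)) {a b : ℝ}
    (ha : 0 ≤ a) (hab : a ≤ b) (hb : b ≤ 1) : (b - a) * g b ≤ ∫ y in a..b, g y := by
  have hi := hg.intervalIntegrable_of_Icc_zero_one ⟨ha, hab.trans hb⟩ ⟨ha.trans hab, hb⟩
  have h := intervalIntegral.integral_mono_on hab intervalIntegrable_const hi fun y hy =>
    hg ⟨ha.trans hy.1, hy.2.trans hb⟩ ⟨ha.trans hab, hb⟩ hy.2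
  simpa using h

lemma tendsto_integral_pow (hg : AntitoneOn g (Icc 0 1)) (hp : p ∈ Ioo (0 : ℝ) 1) :
    Tendsto (fun N : ℕ => ∫ y in p ^ N..1, g y) atTop (𝓝 (∫ y in (0 : ℝ)..1, g y)) := by
  have hi : MeasureTheory.IntegrableOn g (uIcc 1 0) := by
    rw [uIcc_comm, uIcc_of_le zero_le_one]
    exact hg.integrableOn_isCompact isCompact_Icc
  have hc := intervalIntegral.continuousOn_primitive_interval hi
  rw [uIcc_comm, uIcc_of_le zero_le_one] at hc
  have h := (hc 0 (by simp)).tendsto.comp (tendsto_nhdsWithin_iff.2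
    ⟨tendsto_pow_atTop_nhds_zero_of_lt_one hp.1.le hp.2,
      Eventually.of_forall (pow_mem_Icc_zero_one hp)⟩)
  simpa [Function.comp_def, intervalIntegral.integral_symm (1 : ℝ)] using h.neg

lemma integral_pow_le_integral (hg : AntitoneOn g (Icc 0 1)) (h0 : ∀ y ∈ Icc (0 : ℝ) 1, 0 ≤ g y)
    (hp : p ∈ Ioo (0 : ℝ) 1) (N : ℕ) :
    ∫ y in p ^ (N + 1)..p, g y ≤ ∫ y in (0 : ℝ)..1, g y := by
  refine intervalIntegral.integral_mono_interval (pow_nonneg hp.1.le _)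
    (pow_le_of_le_one hp.1.le hp.2.le (by simp)) hp.2.le ?_
    (hg.intervalIntegrable_of_Icc_zero_one (by simp) (by simp))
  filter_upwards [MeasureTheory.ae_restrict_mem measurableSet_Ioc] with y hy
  exact h0 y ⟨hy.1.le, hy.2⟩

lemma sum_geometric_le_integral (hg : AntitoneOn g (Icc 0 1))
    (h0 : ∀ y ∈ Icc (0 : ℝ) 1, 0 ≤ g y) (hp : p ∈ Ioo (0 : ℝ) 1) (N : ℕ) :
    ∑ i ∈ Finset.range N, (p ^ i - p ^ (i + 1)) * g (p ^ (i + 1)) ≤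
      p⁻¹ * ∫ y in (0 : ℝ)..1, g y := by
  have hp0 := hp.1
  rw [le_inv_mul_iff₀ hp0, Finset.mul_sum]
  have hstep : ∀ i ∈ Finset.range N, p * ((p ^ i - p ^ (i + 1)) * g (p ^ (i + 1))) ≤
      ∫ y in p ^ (i + 2)..p ^ (i + 1), g y := fun i _ => by
    refine le_of_eq_of_le (by ring) (hg.sub_mul_le_integral (pow_mem_Icc_zero_one hp (i + 2)).1
      (pow_le_pow_of_le_one hp0.le hp.2.le (by simp)) (pow_mem_Icc_zero_one hp _).2)
  refine (Finset.sum_le_sum hstep).trans (le_trans (le_of_eq ?_)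
    (integral_pow_le_integral hg h0 hp N))
  have h1 := sum_integral_geometric hg hp (N + 1)
  rw [Finset.sum_range_succ'] at h1
  have h2 := intervalIntegral.integral_add_adjacent_intervals
    (hg.intervalIntegrable_of_Icc_zero_one (pow_mem_Icc_zero_one hp (N + 1)) ⟨hp0.le, hp.2.le⟩)
    (hg.intervalIntegrable_of_Icc_zero_one ⟨hp0.le, hp.2.le⟩ (by simp : (1 : ℝ) ∈ Icc (0 : ℝ) 1))
  simp only [zero_add, pow_one, pow_zero] at h1
  exact add_right_cancel (h1.trans h2.symm)

lemma integral_le_sum_geometric (hg : AntitoneOn g (Icc 0 1)) (hp : p ∈ Ioo (0 : ℝ) 1) (N : ℕ) :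
    ∫ y in p ^ N..1, g y ≤
      ∑ i ∈ Finset.range N, (p ^ i - p ^ (i + 1)) * g (p ^ (i + 1)) := by
  rw [← sum_integral_geometric hg hp]
  exact Finset.sum_le_sum fun i _ => hg.integral_le_sub_mul (pow_mem_Icc_zero_one hp _).1
    (pow_le_pow_of_le_one hp.1.le hp.2.le (by simp)) (pow_mem_Icc_zero_one hp _).2

end GeometricPartition

lemma one_add_mul_one_sub_bounds {p : ℝ} (hp : p ∈ Ioo (0 : ℝ) 1) (n : ℕ) :
    p * (p ^ n * (1 - Real.log (p ^ n))) ≤ p ^ n * (1 + n * (1 - p)) ∧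
      p ^ n * (1 + n * (1 - p)) ≤ p ^ n * (1 - Real.log (p ^ n)) := by
  have hn : (0 : ℝ) ≤ n := n.cast_nonneg
  have hpn : 0 ≤ p ^ n := pow_nonneg hp.1.le n
  have hlower := Real.one_sub_inv_le_log_of_pos hp.1
  have hupper := Real.log_le_sub_one_of_pos hp.1
  have hp_log : p * -Real.log p ≤ 1 - p := by
    have := mul_le_mul_of_nonneg_left hlower hp.1.le
    rw [mul_sub, mul_inv_cancel₀ hp.1.ne'] at this
    linarith
  rw [Real.log_pow, mul_left_comm]
  constructor <;> apply mul_le_mul_of_nonneg_left _ hpn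
  · nlinarith [mul_le_mul_of_nonneg_left hp_log hn, hp.2]
  · nlinarith [mul_le_mul_of_nonneg_left hupper hn]

lemma antitoneOn_one_div_mul_one_sub_log {c : ℝ} (hc : 0 < c) :
    AntitoneOn (fun y : ℝ => 1 / (y * (1 - Real.log y) + c)) (Icc 0 1) := fun a ha b hb hab =>
  one_div_le_one_div_of_le (add_pos_of_nonneg_of_pos (mul_one_sub_log_nonneg ha) hc)
    (by simpa using monotoneOn_mul_one_sub_log ha hb hab)

lemma tsum_mem_Icc_integral {c p : ℝ} (hc : 0 < c) (hp : p ∈ Ioo (0 : ℝ) 1) :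
    ∑' i : ℕ, (p ^ i - p ^ (i + 1)) / (p ^ (i + 1) * (1 + (i + 1 : ℕ) * (1 - p)) + c) ∈
      Icc (∫ y in (0 : ℝ)..1, 1 / (y * (1 - Real.log y) + c))
        (p⁻¹ * (p⁻¹ * ∫ y in (0 : ℝ)..1, 1 / (y * (1 - Real.log y) + c))) := by
  set g : ℝ → ℝ := fun y => 1 / (y * (1 - Real.log y) + c) with hg_def
  have hg : AntitoneOn g (Icc 0 1) := antitoneOn_one_div_mul_one_sub_log hc
  have h0 : ∀ y ∈ Icc (0 : ℝ) 1, 0 ≤ g y := fun y hy =>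
    one_div_nonneg.2 (add_pos_of_nonneg_of_pos (mul_one_sub_log_nonneg hy) hc).le
  have hd : ∀ i : ℕ, 0 ≤ p ^ i - p ^ (i + 1) := fun i =>
    sub_nonneg.2 (pow_le_pow_of_le_one hp.1.le hp.2.le (by simp))
  set t : ℕ → ℝ := fun i =>
    (p ^ i - p ^ (i + 1)) / (p ^ (i + 1) * (1 + (i + 1 : ℕ) * (1 - p)) + c) with ht_def
  have hD : ∀ i : ℕ, 0 < p ^ (i + 1) * (1 + (i + 1 : ℕ) * (1 - p)) + c := fun i =>
    add_pos_of_nonneg_of_pos (mul_nonneg (pow_nonneg hp.1.le _)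
      (add_nonneg zero_le_one (mul_nonneg (Nat.cast_nonneg _) (sub_nonneg.2 hp.2.le)))) hc
  have ht0 : ∀ i, 0 ≤ t i := fun i => div_nonneg (hd i) (hD i).le
  have hlow : ∀ i, (p ^ i - p ^ (i + 1)) * g (p ^ (i + 1)) ≤ t i := fun i => by
    rw [hg_def, ht_def]
    dsimp only
    rw [mul_one_div]
    exact div_le_div_of_nonneg_left (hd i) (hD i)
      (by linarith [(one_add_mul_one_sub_bounds hp (i + 1)).2])
  have hupp : ∀ i, t i ≤ p⁻¹ * ((p ^ i - p ^ (i + 1)) * g (p ^ (i + 1))) := fun i => by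
    have hφ := mul_one_sub_log_nonneg (pow_mem_Icc_zero_one hp (i + 1))
    rw [hg_def, ht_def]
    dsimp only
    rw [mul_one_div, inv_mul_eq_div, div_div]
    refine div_le_div_of_nonneg_left (hd i)
      (mul_pos (add_pos_of_nonneg_of_pos hφ hc) hp.1) ?_
    nlinarith [(one_add_mul_one_sub_bounds hp (i + 1)).1, hp.2]
  have hsum : ∀ N, ∑ i ∈ Finset.range N, t i ≤ p⁻¹ * (p⁻¹ * ∫ y in (0 : ℝ)..1, g y) := fun N => by
    refine (Finset.sum_le_sum fun i _ => hupp i).trans ?_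
    rw [← Finset.mul_sum]
    exact mul_le_mul_of_nonneg_left (sum_geometric_le_integral hg h0 hp N) (inv_nonneg.2 hp.1.le)
  have hs : Summable t := summable_of_sum_range_le ht0 hsum
  refine ⟨le_of_tendsto (tendsto_integral_pow hg hp) (Eventually.of_forall fun N => ?_),
    Real.tsum_le_of_sum_range_le ht0 hsum⟩
  exact ((integral_le_sum_geometric hg hp N).trans (Finset.sum_le_sum fun i _ => hlow i)).trans
    (hs.sum_le_tsum _ fun i _ => ht0 i)

theorem stmt14 (η : ℝ) (hη : η ∈ Set.Ioo (0 : ℝ) 1) :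
    Filter.Tendsto
      (fun p : ℝ => ∑' i : ℕ,
        (p ^ i - p ^ (i + 1)) /
          (((i : ℝ) + 2) * p ^ (i + 1) - ((i : ℝ) + 1) * p ^ (i + 2) + 1 / η - 1))
      (nhdsWithin 1 (Set.Iio 1))
      (nhds (∫ y in (0 : ℝ)..1, 1 / (y * (1 - Real.log y) + 1 / η - 1))) := by
  have hc : 0 < 1 / η - 1 := sub_pos.2 ((one_lt_div hη.1).2 hη.2)
  have hterm (p : ℝ) (i : ℕ) :
      ((i : ℝ) + 2) * p ^ (i + 1) - ((i : ℝ) + 1) * p ^ (i + 2) + 1 / η - 1 =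
        p ^ (i + 1) * (1 + (i + 1 : ℕ) * (1 - p)) + (1 / η - 1) := by
    push_cast
    ring
  simp only [hterm, add_sub_assoc]
  have hmem : ∀ᶠ p : ℝ in 𝓝[<] 1, p ∈ Ioo (0 : ℝ) 1 := Ioo_mem_nhdsLT zero_lt_one
  have hinv : Tendsto (fun p : ℝ => p⁻¹) (𝓝[<] 1) (𝓝 1) := by
    simpa using (tendsto_inv₀ (one_ne_zero (α := ℝ))).mono_left nhdsWithin_le_nhds
  have hupper := hinv.mul (hinv.mul_const
    (∫ y in (0 : ℝ)..1, 1 / (y * (1 - Real.log y) + (1 / η - 1))))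
  rw [one_mul, one_mul] at hupper
  exact tendsto_of_tendsto_of_tendsto_of_le_of_le' tendsto_const_nhds hupper
    (hmem.mono fun p hp => (tsum_mem_Icc_integral hc hp).1)
    (hmem.mono fun p hp => (tsum_mem_Icc_integral hc hp).2)
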